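/- In the setting above, letting W₂ be the vertical coordinate of a random point with density proportional to e^{-γ y} on D∖B((x̂,y'),R), the variance satisfies 2^{-12} e^{-1} ≤ γ² Var(W₂) ≤ 16/(1 − e^{-1/2}). -/

import Mathlib

open MeasureTheory Real Set

/-- The region `D ∖ B((x̂,y'),R)` where `D = D_b × (0,∞)`. -/
def gasRegion {E : Type*} [NormedAddCommGroup E]
    (Db : Set E) (xh : E) (R y' : ℝ) : Set (E × ℝ) :=
  {p | p.1 ∈ Db ∧ 0 < p.2 ∧ R ^ 2 < ‖p.1 - xh‖ ^ 2 + (p.2 - y') ^ 2}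

/-- The mass `Q(γ,y') = ∫_{D∖B} γ e^{-γ y} dx dy`. -/
noncomputable def gasMass (d : ℕ) (Db : Set (EuclideanSpace ℝ (Fin (d - 1))))
    (xh : EuclideanSpace ℝ (Fin (d - 1))) (R y' γ : ℝ) : ℝ :=
  ∫ p in gasRegion Db xh R y', γ * exp (-γ * p.2)

/-- The mean height of the normalized measure with density `∝ e^{-γ y}` on `D∖B`. -/
noncomputable def gasMeanHeight (d : ℕ) (Db : Set (EuclideanSpace ℝ (Fin (d - 1))))
    (xh : EuclideanSpace ℝ (Fin (d - 1))) (R y' γ : ℝ) : ℝ :=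
  (∫ p in gasRegion Db xh R y', p.2 * (γ * exp (-γ * p.2))) / gasMass d Db xh R y' γ

/-- The variance of the vertical coordinate `W₂` of a random point with density
`∝ e^{-γ y}` on `D∖B`, i.e. `w/q − u²`. -/
noncomputable def gasHeightVar (d : ℕ) (Db : Set (EuclideanSpace ℝ (Fin (d - 1))))
    (xh : EuclideanSpace ℝ (Fin (d - 1))) (R y' γ : ℝ) : ℝ :=
  (∫ p in gasRegion Db xh R y', p.2 ^ 2 * (γ * exp (-γ * p.2))) / gasMass d Db xh R y' γ
    - (gasMeanHeight d Db xh R y' γ) ^ 2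

section ExponentialMoments

variable {γ : ℝ}

lemma integrableOn_pow_mul_exp_Ioi (hγ : 0 < γ) (k : ℕ) :
    IntegrableOn (fun y : ℝ => y ^ k * (γ * exp (-γ * y))) (Ioi 0) := by
  have h := integrableOn_rpow_mul_exp_neg_mul_rpow (p := 1) (s := k) (b := γ)
    (by have : (0 : ℝ) ≤ k := k.cast_nonneg
        linarith) one_pos hγ
  refine IntegrableOn.congr_fun (h.const_mul γ) (fun y _ => ?_) measurableSet_Ioi
  simp only [rpow_natCast, rpow_one]
  ring

lemma integral_pow_mul_exp_Ioi (hγ : 0 < γ) (k : ℕ) :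
    ∫ y in Ioi (0 : ℝ), y ^ k * (γ * exp (-γ * y)) = k.factorial / γ ^ k := by
  have h := integral_rpow_mul_exp_neg_mul_Ioi (a := (k : ℝ) + 1) (r := γ) (by positivity) hγ
  rw [Real.Gamma_nat_eq_factorial] at h
  have h2 : ∫ y in Ioi (0 : ℝ), y ^ k * (γ * exp (-γ * y))
      = γ * ∫ y in Ioi (0 : ℝ), y ^ ((k : ℝ) + 1 - 1) * exp (-(γ * y)) := by
    rw [← integral_const_mul]
    refine integral_congr_ae (Filter.Eventually.of_forall fun y => ?_)
    simp only [add_sub_cancel_right, rpow_natCast, neg_mul]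
    ring
  rw [h2, h]
  have h3 : (1 / γ) ^ ((k : ℝ) + 1) = (1 / γ) ^ (k + 1) := by
    exact_mod_cast rpow_natCast (1 / γ) (k + 1)
  rw [h3, div_pow, one_pow, pow_succ]
  field_simp

lemma integral_exp_Ioo {a b : ℝ} (hab : a ≤ b) :
    ∫ y in Ioo a b, γ * exp (-γ * y) = exp (-γ * a) - exp (-γ * b) := by
  rw [← integral_Ioc_eq_integral_Ioo, ← intervalIntegral.integral_of_le hab]
  have := intervalIntegral.integral_eq_sub_of_hasDerivAt (a := a) (b := b)
    (f := fun y => -exp (-γ * y)) (f' := fun y => γ * exp (-γ * y))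
    (fun y _ => by
      have h : HasDerivAt (fun y => -exp (-γ * y)) (-(exp (-γ * y) * (-γ * 1))) y :=
        (((hasDerivAt_id y).const_mul (-γ)).exp).neg
      exact h.congr_deriv (by ring))
    (Continuous.intervalIntegrable (by fun_prop) _ _)
  rw [this]
  ring

lemma le_integral_sq_sub_Ioo {a b : ℝ} (hab : a ≤ b) (m : ℝ) :
    (b - a) ^ 3 / 12 ≤ ∫ y in Ioo a b, (y - m) ^ 2 := by
  rw [← integral_Ioc_eq_integral_Ioo, ← intervalIntegral.integral_of_le hab,
    intervalIntegral.integral_comp_sub_right (fun y => y ^ 2), integral_pow]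
  norm_num
  nlinarith [mul_nonneg (sub_nonneg.2 hab) (sq_nonneg (a + b - 2 * m))]

lemma le_integral_sq_sub_mul_exp_Ioo (hγ : 0 < γ) {a b : ℝ} (hab : a ≤ b) (m : ℝ) :
    γ * exp (-γ * b) * ((b - a) ^ 3 / 12)
      ≤ ∫ y in Ioo a b, (y - m) ^ 2 * (γ * exp (-γ * y)) := by
  have hint : ∀ f : ℝ → ℝ, Continuous f → IntegrableOn f (Ioo a b) := fun f hf =>
    (hf.integrableOn_Icc (a := a) (b := b)).mono_set Ioo_subset_Icc_self
  calc γ * exp (-γ * b) * ((b - a) ^ 3 / 12)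
      ≤ γ * exp (-γ * b) * ∫ y in Ioo a b, (y - m) ^ 2 := by
        gcongr
        exact le_integral_sq_sub_Ioo hab m
    _ = ∫ y in Ioo a b, γ * exp (-γ * b) * (y - m) ^ 2 := (integral_const_mul _ _).symm
    _ ≤ _ := by
        refine setIntegral_mono_on (hint _ (by fun_prop)) (hint _ (by fun_prop))
          measurableSet_Ioo fun y hy => ?_
        have : exp (-γ * b) ≤ exp (-γ * y) := exp_le_exp.2 (by nlinarith [hy.2])
        rw [mul_comm]
        gcongr

end ExponentialMoments

section Region

variable {E : Type*} [NormedAddCommGroup E]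

lemma gasRegion_subset_prod (Db : Set E) (xh : E) (R y' : ℝ) :
    gasRegion Db xh R y' ⊆ Db ×ˢ Ioi 0 := fun _ hp => ⟨hp.1, hp.2.1⟩

lemma diff_closedBall_prod_subset_gasRegion (Db : Set E) (xh : E) {R y' b : ℝ} (hR : 0 < R)
    (hb : b ≤ y' - R / 2) :
    (Db \ Metric.closedBall xh (7 / 8 * R)) ×ˢ Ioo 0 b ⊆ gasRegion Db xh R y' := by
  rintro ⟨x, y⟩ ⟨⟨hx, hxb⟩, hy0, hyb⟩
  refine ⟨hx, hy0, ?_⟩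
  simp only [Metric.mem_closedBall, dist_eq_norm, not_le] at hxb hyb ⊢
  nlinarith

lemma prod_Ioo_subset_gasRegion (Db : Set E) (xh : E) {R y' a b : ℝ} (hR : 0 < R) (hy' : 0 ≤ y')
    (ha : y' + R ≤ a) : Db ×ˢ Ioo a b ⊆ gasRegion Db xh R y' := by
  rintro ⟨x, y⟩ ⟨hx, hya, -⟩
  refine ⟨hx, ?_, ?_⟩
  · simp only at hya ⊢
    linarith
  · simp only at hya ⊢
    nlinarith [sq_nonneg ‖x - xh‖]

variable [NormedSpace ℝ E] [MeasurableSpace E] [BorelSpace E] [FiniteDimensional ℝ E]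

lemma measureReal_closedBall_mul_le [Nontrivial E] (μ : Measure E) [μ.IsAddHaarMeasure] (x : E)
    {r R : ℝ} (hr : 0 ≤ r) (hr1 : r ≤ 1) (hR : 0 ≤ R) :
    μ.real (Metric.closedBall x (r * R)) ≤ r * μ.real (Metric.ball x R) := by
  have hn : Module.finrank ℝ E ≠ 0 := Module.finrank_pos.ne'
  rw [measureReal_def, measureReal_def, Measure.addHaar_closedBall _ _ (by positivity),
    Measure.addHaar_ball _ _ hR, ENNReal.toReal_mul, ENNReal.toReal_mul,
    ENNReal.toReal_ofReal (by positivity), ENNReal.toReal_ofReal (by positivity), mul_pow,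
    mul_assoc]
  gcongr
  exact pow_le_of_le_one hr hr1 hn

lemma le_measureReal_diff_closedBall [Nontrivial E] (μ : Measure E) [μ.IsAddHaarMeasure]
    {s : Set E} (hs : Bornology.IsBounded s) {x : E} {R : ℝ} (hR : 0 < R)
    (hball : Metric.ball x R ⊆ s) :
    1 / 8 * μ.real s ≤ μ.real (s \ Metric.closedBall x (7 / 8 * R)) := by
  have hsfin : μ s ≠ ⊤ := hs.measure_lt_top.ne
  have hsub : Metric.closedBall x (7 / 8 * R) ⊆ s :=
    (Metric.closedBall_subset_ball (by linarith)).trans hball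
  have h1 := measureReal_closedBall_mul_le μ x (r := 7 / 8) (by norm_num) (by norm_num) hR.le
  have h2 : μ.real (Metric.ball x R) ≤ μ.real s := measureReal_mono hball hsfin
  have h3 := measureReal_sdiff (μ := μ) hsub Metric.isClosed_closedBall.measurableSet hsfin
  linarith

end Region

lemma setIntegral_prod_snd {E : Type*} [MeasurableSpace E] (μ : Measure E) [SFinite μ]
    (s : Set E) (t : Set ℝ) (g : ℝ → ℝ) :
    ∫ p in s ×ˢ t, g p.2 ∂(μ.prod volume) = μ.real s * ∫ y in t, g y := by
  have := setIntegral_prod_mul (μ := μ) (ν := (volume : Measure ℝ)) (fun _ => (1 : ℝ)) g s t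
  simpa using this

lemma integrableOn_prod_snd {E : Type*} [MeasurableSpace E] {μ : Measure E} [SFinite μ]
    {s : Set E} {t : Set ℝ} {g : ℝ → ℝ} (hs : μ s ≠ ⊤) (hg : IntegrableOn g t) :
    IntegrableOn (fun p : E × ℝ => g p.2) (s ×ˢ t) (μ.prod volume) := by
  have : IsFiniteMeasure (μ.restrict s) := ⟨by simpa using hs.lt_top⟩
  rw [IntegrableOn, ← Measure.prod_restrict]
  exact hg.comp_snd _

/-- A slab `A × (a/γ, b/γ)` of large mass inside the region, on which the height fluctuates. -/
lemma exists_slab_subset_gasRegion {E : Type*} [NormedAddCommGroup E] [NormedSpace ℝ E]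
    [MeasurableSpace E] [BorelSpace E] [FiniteDimensional ℝ E] [Nontrivial E]
    (μ : Measure E) [μ.IsAddHaarMeasure] {Db : Set E} (hDbb : Bornology.IsBounded Db)
    {R γ y' : ℝ} (hR : 0 < R) {xh : E} (hball : Metric.ball xh R ⊆ Db)
    (hγ : 0 < γ) (hy' : R ≤ y') :
    ∃ (A : Set E) (a b c : ℝ), 0 ≤ a ∧ a ≤ b ∧ c * μ.real Db ≤ μ.real A ∧
      A ×ˢ Ioo (a / γ) (b / γ) ⊆ gasRegion Db xh R y' ∧
      (1 - exp (-(1 / 2))) / 8 ≤ c * (exp (-a) - exp (-b)) ∧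
      2 ^ (-12 : ℤ) * exp (-1) ≤ c * (exp (-b) * ((b - a) ^ 3 / 12)) := by
  have he : (1 : ℝ) / 8 ≤ exp (-2) := by
    rw [exp_neg, show (2 : ℝ) = 1 + 1 by norm_num, exp_add, one_div]
    exact inv_anti₀ (by positivity) (by nlinarith [exp_one_lt_d9, exp_pos 1])
  have hmono : exp (-1) ≤ exp (-(1 / 2)) := exp_le_exp.2 (by norm_num)
  have hpos := exp_pos (-1)
  rcases le_total (1 / 2) (γ * (y' - R / 2)) with h | h
  · refine ⟨Db \ Metric.closedBall xh (7 / 8 * R), 0, 1 / 2, 1 / 8, le_rfl, by norm_num,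
      le_measureReal_diff_closedBall μ hDbb hR hball, ?_, ?_, ?_⟩
    · rw [zero_div]
      refine diff_closedBall_prod_subset_gasRegion Db xh hR ?_
      rw [div_le_iff₀ hγ]
      linarith
    · rw [neg_zero, exp_zero]
      linarith
    · norm_num at hpos ⊢
      linarith
  · refine ⟨Db, 2, 3, 1, by norm_num, by norm_num, by simp, ?_, ?_, ?_⟩
    · refine prod_Ioo_subset_gasRegion Db xh hR (by linarith) ?_
      rw [le_div_iff₀ hγ]
      nlinarith
    · have h1 : exp (-1) < 1 := exp_lt_one_iff.2 (by norm_num)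
      rw [show (-3 : ℝ) = -2 + -1 by norm_num, exp_add]
      nlinarith
    · rw [show (-3 : ℝ) = -2 + -1 by norm_num, exp_add]
      norm_num at he hpos ⊢
      nlinarith

/-- `2^{-12} e^{-1} ≤ γ² Var(W₂) ≤ 16/(1−e^{-1/2})`. -/
theorem archimedes_height_variance_bounds (d : ℕ) (hd : 2 ≤ d)
    (Db : Set (EuclideanSpace ℝ (Fin (d - 1)))) (hDb : MeasurableSet Db)
    (hDbb : Bornology.IsBounded Db) (hDbpos : 0 < volume Db)
    (R : ℝ) (hR : 0 < R) (xh : EuclideanSpace ℝ (Fin (d - 1)))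
    (hball : Metric.ball xh R ⊆ Db)
    (γ y' : ℝ) (hγ : 0 < γ) (hy' : R ≤ y') :
    2 ^ (-12 : ℤ) * exp (-1) ≤ γ ^ 2 * gasHeightVar d Db xh R y' γ
      ∧ γ ^ 2 * gasHeightVar d Db xh R y' γ ≤ 16 / (1 - exp (-(1 / 2))) := by
  have hfr : Module.finrank ℝ (EuclideanSpace ℝ (Fin (d - 1))) = d - 1 := by simp
  have : Nontrivial (EuclideanSpace ℝ (Fin (d - 1))) :=
    Module.nontrivial_of_finrank_pos (R := ℝ) (by omega)
  have hfin : volume Db ≠ ⊤ := hDbb.measure_lt_top.ne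
  obtain ⟨A, a, b, c, ha, hab, hA, hsub, hmass, hvar⟩ :=
    exists_slab_subset_gasRegion volume hDbb hR hball hγ hy'
  set S := gasRegion Db xh R y'
  set V := volume.real Db
  have hVpos : 0 < V := ENNReal.toReal_pos hDbpos.ne' hfin
  have hSsub : S ⊆ Db ×ˢ Ioi 0 := gasRegion_subset_prod Db xh R y'
  set w : ℝ → ℝ := fun y => γ * exp (-γ * y)
  have hwpos : ∀ y, 0 ≤ w y := fun y => by positivity
  have hint (k : ℕ) : IntegrableOn (fun p : EuclideanSpace ℝ (Fin (d - 1)) × ℝ =>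
      p.2 ^ k * w p.2) (Db ×ˢ Ioi 0) :=
    integrableOn_prod_snd hfin (integrableOn_pow_mul_exp_Ioi hγ k)
  have hintS (k : ℕ) := (hint k).mono_set hSsub
  have hupper (k : ℕ) (hk : Even k) :
      ∫ p in S, p.2 ^ k * w p.2 ≤ V * (k.factorial / γ ^ k) := by
    rw [← integral_pow_mul_exp_Ioi hγ k, ← setIntegral_prod_snd volume]
    exact setIntegral_mono_set (hint k)
      (Filter.Eventually.of_forall fun p => mul_nonneg (hk.pow_nonneg _) (hwpos _))
      hSsub.eventuallyLE
  have hlower (g : ℝ → ℝ) (hg : ∀ y, 0 ≤ g y)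
      (hgS : IntegrableOn (fun p : EuclideanSpace ℝ (Fin (d - 1)) × ℝ => g p.2) S) :
      c * V * ∫ y in Ioo (a / γ) (b / γ), g y ≤ ∫ p in S, g p.2 := by
    calc _ ≤ volume.real A * ∫ y in Ioo (a / γ) (b / γ), g y := by
          gcongr
          exact integral_nonneg hg
      _ = ∫ p in A ×ˢ Ioo (a / γ) (b / γ), g p.2 := (setIntegral_prod_snd volume A _ g).symm
      _ ≤ _ := setIntegral_mono_set hgS (Filter.Eventually.of_forall fun p => hg _)
          hsub.eventuallyLE
  have hab' : a / γ ≤ b / γ := by gcongr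
  have hγa : -γ * (a / γ) = -a := by field_simp
  have hγb : -γ * (b / γ) = -b := by field_simp
  set Q := gasMass d Db xh R y' γ
  set m := gasMeanHeight d Db xh R y' γ
  have hQdef : Q = ∫ p in S, w p.2 := rfl
  have hQle : Q ≤ V := by simpa [hQdef] using hupper 0 (by decide)
  have hε : 0 < 1 - exp (-(1 / 2)) := sub_pos.2 (exp_lt_one_iff.2 (by norm_num))
  have hQge : V * ((1 - exp (-(1 / 2))) / 8) ≤ Q := by
    have h := hlower w hwpos (by simpa using hintS 0)
    rw [integral_exp_Ioo hab', hγa, hγb] at h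
    rw [hQdef]
    nlinarith
  have hQpos : 0 < Q := lt_of_lt_of_le (by positivity) hQge
  have hm1 : ∫ p in S, p.2 * w p.2 = m * Q := (div_mul_cancel₀ _ hQpos.ne').symm
  have hvardef : gasHeightVar d Db xh R y' γ = (∫ p in S, p.2 ^ 2 * w p.2) / Q - m ^ 2 := rfl
  have hexpand : (fun p : EuclideanSpace ℝ (Fin (d - 1)) × ℝ => (p.2 - m) ^ 2 * w p.2)
      = fun p => p.2 ^ 2 * w p.2 - 2 * m * (p.2 ^ 1 * w p.2) + m ^ 2 * (p.2 ^ 0 * w p.2) := by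
    funext p
    ring
  have hint1 : IntegrableOn (fun p : EuclideanSpace ℝ (Fin (d - 1)) × ℝ =>
      p.2 ^ 2 * w p.2 - 2 * m * (p.2 ^ 1 * w p.2)) S :=
    (hintS 2).sub ((hintS 1).const_mul (2 * m))
  have hint0 := (hintS 0).const_mul (m ^ 2)
  have hcentral : ∫ p in S, (p.2 - m) ^ 2 * w p.2 = (∫ p in S, p.2 ^ 2 * w p.2) - m ^ 2 * Q := by
    rw [hexpand, integral_add hint1 hint0, integral_sub (hintS 2) ((hintS 1).const_mul (2 * m)),
      integral_const_mul, integral_const_mul]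
    simp only [pow_one, pow_zero, one_mul]
    rw [hm1, ← hQdef]
    ring
  rw [hvardef]
  constructor
  · have h := hlower (fun y => (y - m) ^ 2 * w y) (fun y => mul_nonneg (sq_nonneg _) (hwpos y))
      (by rw [hexpand]; exact hint1.add hint0)
    have h1 := le_integral_sq_sub_mul_exp_Ioo hγ hab' m
    rw [hγb] at h1
    have hc : 0 ≤ c := by
      by_contra! hc
      have : 0 ≤ exp (-a) - exp (-b) := sub_nonneg.2 (exp_le_exp.2 (by linarith))
      nlinarith
    have h2 : 2 ^ (-12 : ℤ) * exp (-1) * V ≤ γ ^ 2 * ∫ p in S, (p.2 - m) ^ 2 * w p.2 := by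
      calc 2 ^ (-12 : ℤ) * exp (-1) * V ≤ c * (exp (-b) * ((b - a) ^ 3 / 12)) * V := by gcongr
        _ = γ ^ 2 * (c * V * (γ * exp (-b) * ((b / γ - a / γ) ^ 3 / 12))) := by
            field_simp
        _ ≤ γ ^ 2 * (c * V * ∫ y in Ioo (a / γ) (b / γ), (y - m) ^ 2 * w y) := by gcongr
        _ ≤ _ := by gcongr
    have h3 : (∫ p in S, p.2 ^ 2 * w p.2) / Q - m ^ 2
        = (∫ p in S, (p.2 - m) ^ 2 * w p.2) / Q := by
      rw [hcentral]
      field_simp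
    rw [h3, ← mul_div_assoc, le_div_iff₀ hQpos]
    refine le_trans ?_ h2
    gcongr
  · have h := hupper 2 (by decide)
    have h1 : γ ^ 2 * ((∫ p in S, p.2 ^ 2 * w p.2) / Q) ≤ 16 / (1 - exp (-(1 / 2))) := by
      rw [← mul_div_assoc, div_le_div_iff₀ hQpos hε]
      have h2 : γ ^ 2 * ∫ p in S, p.2 ^ 2 * w p.2 ≤ 2 * V := by
        calc _ ≤ γ ^ 2 * (V * ((2 : ℕ).factorial / γ ^ 2)) := by gcongr
          _ = 2 * V := by
            simp only [Nat.factorial_two, Nat.cast_ofNat]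
            field_simp
      nlinarith
    nlinarith [mul_nonneg (sq_nonneg γ) (sq_nonneg m)]
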